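/- arXiv:2402.16074 — 2 statements merged into one kernel-verified Lean document; each statement's English description precedes it below -/
import Mathlib

section
/- For every integer l ≥ 1 the Whittaker polynomials satisfy the Pieri rule (x + x^{−1}) · W_l(x) = W_{l+1}(x) + (1 − q^{2l}) · W_{l−1}(x) in ℚ(q)[x, x^{−1}]; with the convention W_{−1} = 0 the identity also holds for l = 0. -/
/-!
STATEMENT 1: For every integer `l ≥ 1` the Whittaker polynomials satisfy the Pieri rule
`(x + x⁻¹) · W_l(x) = W_{l+1}(x) + (1 − q^{2l}) · W_{l−1}(x)` in `ℚ(q)[x, x⁻¹]`;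
with the convention `W_{−1} = 0` the identity also holds for `l = 0`.

We realize `ℚ(q)` as `RatFunc ℚ` (with `q = RatFunc.X`) and Laurent polynomials in `x`
as `LaurentPolynomial (RatFunc ℚ)`, with `x^n = LaurentPolynomial.T n`.
-/

noncomputable section

/-- The field `ℚ(q)`. -/
abbrev K : Type := RatFunc ℚ

/-- The element `q`. -/
def q : K := RatFunc.X

/-- The q-Pochhammer symbol `(q²;q²)_n = ∏_{k=0}^{n-1} (1 - (q²)^k · q²)`. -/
def qPoch (n : ℕ) : K := ∏ k ∈ Finset.range n, (1 - (q ^ 2) ^ k * q ^ 2)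

/-- The Gaussian binomial coefficient `binom(l,k)_{q²}`. -/
def qBinom (l k : ℕ) : K := qPoch l / (qPoch k * qPoch (l - k))

/-- The Whittaker polynomial `W_l = ∑_{k=0}^{l} binom(l,k)_{q²} x^{l-2k}` as a Laurent
polynomial over `ℚ(q)`. -/
def W (l : ℕ) : LaurentPolynomial K :=
  ∑ k ∈ Finset.range (l + 1),
    LaurentPolynomial.C (qBinom l k) * LaurentPolynomial.T ((l : ℤ) - 2 * k)

lemma one_sub_ne (k : ℕ) : (1 - (q ^ 2) ^ k * q ^ 2 : K) ≠ 0 := by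
  intro h
  have h1 : (RatFunc.X : RatFunc ℚ) ^ (2 * k + 2) = 1 := by
    have h2 := (sub_eq_zero.mp h).symm
    rw [← pow_mul, ← pow_add] at h2
    exact h2
  rw [← RatFunc.algebraMap_X, ← map_pow, ← map_one (algebraMap (Polynomial ℚ) (RatFunc ℚ))] at h1
  have h3 := RatFunc.algebraMap_injective ℚ h1
  have h4 := congrArg Polynomial.natDegree h3
  simp at h4

lemma qPoch_ne (n : ℕ) : qPoch n ≠ 0 :=
  Finset.prod_ne_zero_iff.mpr fun k _ => one_sub_ne k

lemma qPoch_succ (n : ℕ) : qPoch (n + 1) = qPoch n * (1 - (q ^ 2) ^ n * q ^ 2) :=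
  Finset.prod_range_succ _ _

lemma qPoch_zero : qPoch 0 = 1 := by simp [qPoch]

lemma qBinom_zero (l : ℕ) : qBinom l 0 = 1 := by
  simp [qBinom, qPoch_zero, qPoch_ne]

lemma qBinom_self (l : ℕ) : qBinom l l = 1 := by
  simp [qBinom, qPoch_zero, qPoch_ne]

lemma qBinom_rec (k j : ℕ) :
    qBinom (k + j + 1) (k + 1) + qBinom (k + j + 1) k
      = qBinom (k + j + 2) (k + 1) + (1 - q ^ (2 * (k + j + 1))) * qBinom (k + j) k := by
  unfold qBinom
  rw [show k + j + 1 - (k + 1) = j by omega, show k + j + 1 - k = j + 1 by omega,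
    show k + j + 2 - (k + 1) = j + 1 by omega, show k + j - k = j by omega]
  rw [qPoch_succ (k + j + 1), qPoch_succ (k + j), qPoch_succ k, qPoch_succ j]
  have a := qPoch_ne k
  have b := qPoch_ne j
  have c := one_sub_ne k
  have d := one_sub_ne j
  generalize qPoch k = A at *
  generalize qPoch j = B at *
  generalize qPoch (k + j) = D at *
  have e : q ^ (2 * (k + j + 1)) = (q ^ 2) ^ k * (q ^ 2) ^ j * q ^ 2 := by ring
  have f : (q ^ 2) ^ (k + j + 1) = (q ^ 2) ^ k * (q ^ 2) ^ j * q ^ 2 := by ring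
  rw [e, f, pow_add]
  generalize (q ^ 2) ^ k = x at *
  generalize (q ^ 2) ^ j = y at *
  generalize q ^ 2 = z at *
  field_simp
  ring

open LaurentPolynomial in
lemma W_pieri_succ (m : ℕ) :
    (T 1 + T (-1)) * W (m + 1) = W (m + 2) + C (1 - q ^ (2 * (m + 1))) * W m := by
  have hA : (T 1 : LaurentPolynomial K) * W (m + 1) = T (m + 2 : ℤ) +
      ∑ k ∈ Finset.range (m + 1), C (qBinom (m + 1) (k + 1)) * T ((m : ℤ) - 2 * k) := by
    unfold W
    rw [Finset.mul_sum, Finset.sum_range_succ', add_comm]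
    congr 1
    · rw [qBinom_zero, map_one, one_mul, ← T_add]
      congr 1; push_cast; ring
    · refine Finset.sum_congr rfl fun k _ => ?_
      rw [mul_left_comm, ← T_add]
      congr 2; push_cast; ring
  have hB : (T (-1) : LaurentPolynomial K) * W (m + 1) =
      ∑ k ∈ Finset.range (m + 1), C (qBinom (m + 1) k) * T ((m : ℤ) - 2 * k)
        + T (-(m + 2) : ℤ) := by
    unfold W
    rw [Finset.mul_sum, Finset.sum_range_succ]
    congr 1
    · refine Finset.sum_congr rfl fun k _ => ?_
      rw [mul_left_comm, ← T_add]
      congr 2; push_cast; ring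
    · rw [qBinom_self, map_one, one_mul, ← T_add]
      congr 1; push_cast; ring
  have hC : W (m + 2) = T (m + 2 : ℤ) +
      (∑ k ∈ Finset.range (m + 1), C (qBinom (m + 2) (k + 1)) * T ((m : ℤ) - 2 * k)
        + T (-(m + 2) : ℤ)) := by
    unfold W
    rw [Finset.sum_range_succ', add_comm, Finset.sum_range_succ]
    congr 1
    · rw [qBinom_zero, map_one, one_mul]
      congr 1; all_goals (push_cast; ring)
    · congr 1
      · refine Finset.sum_congr rfl fun k _ => ?_
        congr 2; push_cast; ring
      · rw [qBinom_self, map_one, one_mul]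
        congr 1; push_cast; ring
  have hD : ∑ k ∈ Finset.range (m + 1), C (qBinom (m + 1) (k + 1)) * T ((m : ℤ) - 2 * k)
      + ∑ k ∈ Finset.range (m + 1), C (qBinom (m + 1) k) * T ((m : ℤ) - 2 * k)
      = ∑ k ∈ Finset.range (m + 1), C (qBinom (m + 2) (k + 1)) * T ((m : ℤ) - 2 * k)
      + C (1 - q ^ (2 * (m + 1))) * W m := by
    unfold W
    rw [Finset.mul_sum, ← Finset.sum_add_distrib, ← Finset.sum_add_distrib]
    refine Finset.sum_congr rfl fun k hk => ?_
    obtain ⟨j, rfl⟩ := Nat.exists_eq_add_of_le (Nat.lt_succ_iff.mp (Finset.mem_range.mp hk))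
    rw [← mul_assoc, ← add_mul, ← map_mul, ← map_add, ← add_mul, ← map_add, qBinom_rec]
  rw [add_mul, hA, hB, hC]
  linear_combination hD

/-- The Pieri rule for Whittaker polynomials: for `l ≥ 1`,
`(x + x⁻¹) W_l = W_{l+1} + (1 − q^{2l}) W_{l−1}`, and for `l = 0` (where `W_{-1} = 0`),
`(x + x⁻¹) W_0 = W_1`. -/
theorem whittaker_pieri :
    (∀ l : ℕ, 1 ≤ l →
      (LaurentPolynomial.T 1 + LaurentPolynomial.T (-1)) * W l
        = W (l + 1) + LaurentPolynomial.C (1 - q ^ (2 * l)) * W (l - 1)) ∧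
    (LaurentPolynomial.T 1 + LaurentPolynomial.T (-1)) * W 0 = W 1 := by
  refine ⟨fun l hl => ?_, ?_⟩
  · obtain ⟨m, rfl⟩ := Nat.exists_eq_add_of_le' hl
    exact W_pieri_succ m
  · have h0 : qBinom 1 1 = 1 := qBinom_self 1
    simp [W, Finset.sum_range_succ, qBinom_zero, h0]

end
end

section
/- Multiplication by the discrete quantum dilogarithm Ψ_q^+ intertwines the two cluster realizations of the trace operator L: define c : ℤ → ℚ(q) by c(n) = 1/(q^2;q^2)_n for n ≥ 0 and c(n) = 0 for n < 0. Then for every function f : ℤ → ℚ(q) and every n ∈ ℤ one has c(n) · [ f(n+1) + (1 − q^{2n}) f(n−1) ] = c(n−1) · f(n−1) + (1 − q^{2(n+1)}) · c(n+1) · f(n+1). Equivalently, the multiplication operator f ↦ c·f intertwines the operator ρ_{−1}(L) = V^{−1} + (1 − U^2)V with the operator ρ_0(L) = V + V^{−1}(1 − U^2). -/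
/-!
STATEMENT 9: Multiplication by the discrete quantum dilogarithm `Ψ_q⁺` intertwines the two
cluster realizations of the trace operator `L`: with `c(n) = 1/(q²;q²)_n` for `n ≥ 0` and
`c(n) = 0` for `n < 0`, for every `f : ℤ → ℚ(q)` and every `n ∈ ℤ`,
`c(n)·[f(n+1) + (1 − q^{2n}) f(n−1)] = c(n−1)·f(n−1) + (1 − q^{2(n+1)})·c(n+1)·f(n+1)`.

We realize `ℚ(q)` as `RatFunc ℚ` with `q = RatFunc.X`.
-/

noncomputable section

/-- The discrete quantum dilogarithm `Ψ_q⁺[n] = 1/(q²;q²)_n` for `n ≥ 0`, `0` for `n < 0`. -/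
def c (n : ℤ) : K :=
  if 0 ≤ n then (∏ k ∈ Finset.range n.toNat, (1 - (q ^ 2) ^ k * q ^ 2))⁻¹ else 0

theorem one_sub_q_pow_ne (k : ℕ) : (1 : K) - (q ^ 2) ^ k * q ^ 2 ≠ 0 := by
  intro h
  have h1 : (RatFunc.X : K) ^ (2 * k + 2) = 1 := by
    have := (sub_eq_zero.mp h).symm
    rw [← pow_mul, ← pow_add] at this
    exact this
  have h2 : (Polynomial.X : Polynomial ℚ) ^ (2 * k + 2) = 1 := by
    apply RatFunc.algebraMap_injective ℚ
    rw [map_pow, RatFunc.algebraMap_X, map_one]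
    exact h1
  have h3 := congrArg Polynomial.natDegree h2
  simp at h3

theorem c_rec (n : ℤ) : c (n - 1) = (1 - q ^ (2 * n)) * c n := by
  rcases lt_trichotomy n 0 with h | h | h
  · have h1 : ¬ 0 ≤ n := by omega
    have h2 : ¬ 0 ≤ n - 1 := by omega
    unfold c
    rw [if_neg h1, if_neg h2, mul_zero]
  · subst h
    simp [c]
  · obtain ⟨m, rfl⟩ : ∃ m : ℕ, n = m + 1 := ⟨(n - 1).toNat, by omega⟩
    have e1 : ((m : ℤ) + 1 - 1).toNat = m := by omega
    have e2 : ((m : ℤ) + 1).toNat = m + 1 := by omega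
    have h1 : (0 : ℤ) ≤ (m : ℤ) + 1 := by omega
    have h2 : (0 : ℤ) ≤ (m : ℤ) + 1 - 1 := by omega
    have e3 : q ^ (2 * ((m : ℤ) + 1)) = (q ^ 2) ^ m * q ^ 2 := by
      rw [← pow_mul, ← pow_add, ← zpow_natCast]
      congr 1
    unfold c
    rw [if_pos h1, if_pos h2, e1, e2, e3, Finset.prod_range_succ, mul_inv, mul_comm _⁻¹ _⁻¹,
      mul_inv_cancel_left₀ (one_sub_q_pow_ne m)]

/-- Multiplication by `Ψ_q⁺` intertwines `ρ_{−1}(L) = V⁻¹ + (1 − U²)V` with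
`ρ₀(L) = V + V⁻¹(1 − U²)`. -/
theorem dilogarithm_intertwines_L (f : ℤ → K) (n : ℤ) :
    c n * (f (n + 1) + (1 - q ^ (2 * n)) * f (n - 1))
      = c (n - 1) * f (n - 1) + (1 - q ^ (2 * (n + 1))) * c (n + 1) * f (n + 1) := by
  have h1 := c_rec n
  have h2 := c_rec (n + 1)
  rw [add_sub_cancel_right] at h2
  rw [← h2, h1]
  ring

end
end
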